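/- Let S and S' be two samples of size m that differ in exactly one point, and let h and h' be the minimizers of F_S(g) = R̂_S(g) + λN(g) and F_{S'}(g) = R̂_{S'}(g) + λN(g) respectively, where R̂_S(g) = (1/m)Σ_{z∈S} c(g,z) and c is σ-admissible. Then B_N(h' ∥ h) + B_N(h ∥ h') ≤ (2σ/(mλ)) sup_{x∈S∪S'} |h'(x) − h(x)|. -/

import Mathlib

open MeasureTheory Real

/-- Bregman divergence of a differentiable function `N`:
`B_N(f ∥ g) = N(f) - N(g) - ⟨f - g, ∇N(g)⟩`. -/
noncomputable def bregman {H : Type*} [NormedAddCommGroup H] [NormedSpace ℝ H]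
    (N : H → ℝ) (f g : H) : ℝ :=
  N f - N g - fderiv ℝ N g (f - g)

/-- The first-order lower bound for a convex function differentiable at `x`. -/
theorem ConvexOn.fderiv_sub_le {E : Type*} [NormedAddCommGroup E] [NormedSpace ℝ E]
    {f : E → ℝ} (hf : ConvexOn ℝ Set.univ f) {x : E} (hd : DifferentiableAt ℝ f x) (y : E) :
    fderiv ℝ f x (y - x) ≤ f y - f x := by
  have hline : ConvexOn ℝ Set.univ (f ∘ AffineMap.lineMap (k := ℝ) x y) := by
    simpa using hf.comp_affineMap (AffineMap.lineMap (k := ℝ) x y)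
  have hderiv : HasDerivAt (f ∘ AffineMap.lineMap (k := ℝ) x y) (fderiv ℝ f x (y - x)) 0 := by
    have hx : HasFDerivAt f (fderiv ℝ f x) (AffineMap.lineMap (k := ℝ) x y 0) := by
      simpa using hd.hasFDerivAt
    exact hx.comp_hasDerivAt 0 AffineMap.hasDerivAt_lineMap
  have hslope := hline.le_slope_of_hasDerivAt (Set.mem_univ 0) (Set.mem_univ 1) zero_lt_one hderiv
  simpa [slope_def_field] using hslope

/-- The stationarity condition at a minimizer of a regularized empirical risk. -/
theorem fderiv_regularized_risk_eq_zero {E ι : Type*} [NormedAddCommGroup E] [NormedSpace ℝ E]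
    [Fintype ι] {ℓ : ι → E → ℝ} {N : E → ℝ} {a b : ℝ} {x : E}
    (hℓ : ∀ i, DifferentiableAt ℝ (ℓ i) x) (hN : DifferentiableAt ℝ N x)
    (hmin : ∀ g, a * ∑ i, ℓ i x + b * N x ≤ a * ∑ i, ℓ i g + b * N g) (v : E) :
    a * ∑ i, fderiv ℝ (ℓ i) x v + b * fderiv ℝ N x v = 0 := by
  have hF : HasFDerivAt (fun g => a * ∑ i, ℓ i g + b * N g)
      (a • ∑ i, fderiv ℝ (ℓ i) x + b • fderiv ℝ N x) x :=
    ((HasFDerivAt.fun_sum fun i _ => (hℓ i).hasFDerivAt).const_mul a).add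
      (hN.hasFDerivAt.const_mul b)
  have hzero := IsLocalMin.hasFDerivAt_eq_zero (Filter.Eventually.of_forall hmin) hF
  simpa using congrArg (fun L : E →L[ℝ] ℝ => L v) hzero

/-- **Lemma**: if `h`, `h'` are the minimizers of `F_S = R̂_S + λN` and `F_{S'} = R̂_{S'} + λN`
for two samples of size `m` differing in exactly one point, and the cost `c` is σ-admissible,
then `B_N(h' ∥ h) + B_N(h ∥ h') ≤ (2σ/(mλ)) sup_{x ∈ S ∪ S'} |h'(x) - h(x)|`. -/
theorem bregman_divergence_stability_bound
    {X Y H : Type*} [NormedAddCommGroup H] [NormedSpace ℝ H]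
    (ev : H →ₗ[ℝ] X → ℝ)
    (c : H → X × Y → ℝ) (σ : ℝ)
    (hadm : ∀ (g g' : H) (z : X × Y),
      |c g z - c g' z| ≤ σ * |ev g z.1 - ev g' z.1|)
    (hconv : ∀ z, ConvexOn ℝ Set.univ fun g => c g z)
    (hdiffc : ∀ z, Differentiable ℝ fun g => c g z)
    (N : H → ℝ) (hNnonneg : ∀ g, 0 ≤ N g)
    (hNconv : ConvexOn ℝ Set.univ N) (hNdiff : Differentiable ℝ N)
    (lam : ℝ) (hlam : 0 < lam)
    (m : ℕ) (hm : 0 < m)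
    (s s' : Fin m → X × Y) (j : Fin m) (hdiffer : ∀ i, i ≠ j → s i = s' i)
    (h h' : H)
    (hmin : ∀ g, (1 / (m : ℝ)) * ∑ i : Fin m, c h (s i) + lam * N h
      ≤ (1 / (m : ℝ)) * ∑ i : Fin m, c g (s i) + lam * N g)
    (hmin' : ∀ g, (1 / (m : ℝ)) * ∑ i : Fin m, c h' (s' i) + lam * N h'
      ≤ (1 / (m : ℝ)) * ∑ i : Fin m, c g (s' i) + lam * N g) :
    bregman N h' h + bregman N h h'
      ≤ (2 * σ / (m * lam)) *
        sSup { v : ℝ | ∃ i : Fin m,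
          v = |ev h' (s i).1 - ev h (s i).1| ∨ v = |ev h' (s' i).1 - ev h (s' i).1| } := by
  set V : Set ℝ := { v : ℝ | ∃ i : Fin m,
    v = |ev h' (s i).1 - ev h (s i).1| ∨ v = |ev h' (s' i).1 - ev h (s' i).1| }
  have hfin : V.Finite := by
    refine ((Set.finite_range fun i => |ev h' (s i).1 - ev h (s i).1|).union
      (Set.finite_range fun i => |ev h' (s' i).1 - ev h (s' i).1|)).subset ?_
    rintro v ⟨i, rfl | rfl⟩
    · exact Or.inl ⟨i, rfl⟩
    · exact Or.inr ⟨i, rfl⟩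
  have hσV : ∀ v ∈ V, σ * v ≤ σ * sSup V := by
    intro v hv
    rcases le_or_gt 0 σ with hσ | hσ
    · exact mul_le_mul_of_nonneg_left (le_csSup hfin.bddAbove hv) hσ
    · have hprod : ∀ w ∈ V, 0 ≤ σ * w := by
        rintro w ⟨i, rfl | rfl⟩
        · exact (abs_nonneg _).trans (hadm h' h (s i))
        · exact (abs_nonneg _).trans (hadm h' h (s' i))
      have hnonpos : ∀ w ∈ V, w ≤ 0 := fun w hw => nonpos_of_mul_nonneg_right (hprod w hw) hσ
      have hle : sSup V ≤ v := by
        have hv0 : 0 ≤ v := by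
          obtain ⟨i, rfl | rfl⟩ := hv <;> exact abs_nonneg _
        exact (Real.sSup_nonpos hnonpos).trans hv0
      exact mul_le_mul_of_nonpos_left hle hσ.le
  have hm0 : (0 : ℝ) < m := Nat.cast_pos.mpr hm
  have hstat := fderiv_regularized_risk_eq_zero (ℓ := fun i g => c g (s i))
    (fun i => hdiffc (s i) h) (hNdiff h) hmin (h' - h)
  have hstat' := fderiv_regularized_risk_eq_zero (ℓ := fun i g => c g (s' i))
    (fun i => hdiffc (s' i) h') (hNdiff h') hmin' (h' - h)
  have hlower : ∀ z, fderiv ℝ (fun g => c g z) h (h' - h) ≤ c h' z - c h z :=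
    fun z => (hconv z).fderiv_sub_le (hdiffc z h) h'
  have hupper : ∀ z, c h' z - c h z ≤ fderiv ℝ (fun g => c g z) h' (h' - h) := by
    intro z
    have hz := (hconv z).fderiv_sub_le (hdiffc z h') h
    rw [← neg_sub h' h, map_neg] at hz
    linarith
  have hsum : ∑ i, fderiv ℝ (fun g => c g (s i)) h (h' - h)
      - ∑ i, fderiv ℝ (fun g => c g (s' i)) h' (h' - h) ≤ 2 * σ * sSup V := by
    rw [← Finset.sum_sub_distrib]
    have hbound : ∀ i ∈ Finset.univ, fderiv ℝ (fun g => c g (s i)) h (h' - h)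
        - fderiv ℝ (fun g => c g (s' i)) h' (h' - h)
          ≤ if i = j then 2 * σ * sSup V else 0 := by
      intro i _
      have hl := hlower (s i)
      have hu := hupper (s' i)
      split_ifs with hij
      · have hs := hσV _ ⟨i, Or.inl rfl⟩
        have hs' := hσV _ ⟨i, Or.inr rfl⟩
        have hc := (abs_le.mp (hadm h' h (s i))).2
        have hc' := (abs_le.mp (hadm h' h (s' i))).1
        linarith
      · rw [hdiffer i hij] at hl ⊢
        linarith
    simpa using Finset.sum_le_sum hbound
  have hbreg : bregman N h' h + bregman N h h'
      = fderiv ℝ N h' (h' - h) - fderiv ℝ N h (h' - h) := by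
    rw [bregman, bregman, ← neg_sub h' h, map_neg]
    ring
  have hgrad : m * lam * (fderiv ℝ N h' (h' - h) - fderiv ℝ N h (h' - h))
      = ∑ i, fderiv ℝ (fun g => c g (s i)) h (h' - h)
        - ∑ i, fderiv ℝ (fun g => c g (s' i)) h' (h' - h) := by
    field_simp at hstat hstat'
    linarith
  rw [hbreg, div_mul_eq_mul_div, le_div_iff₀ (mul_pos hm0 hlam), mul_comm, hgrad]
  exact hsum
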